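/- For a trim lattice L, the collection γ(L) = { D^γ(x) : x ∈ L } of downward label sets is a flag simplicial complex on vertex set [n]: it is closed under taking subsets, and a set belongs to γ(L) whenever all of its 2-element subsets do. -/

import Mathlib

/-- An element `x` of a lattice is *left modular* if `(y ⊔ x) ⊓ z = y ⊔ (x ⊓ z)`
for all `y ≤ z`. -/
def LeftModular {L : Type*} [Lattice L] (x : L) : Prop :=
  ∀ y z : L, y ≤ z → (y ⊔ x) ⊓ z = y ⊔ (x ⊓ z)

/-- The data of an extremal lattice of length `n` together with a fixed
maximal-length chain `x₀ ⋖ ⋯ ⋖ xₙ` and the induced numberings of the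
join-irreducibles `j₁, …, jₙ` and meet-irreducibles `m₁, …, mₙ`. -/
structure ExtremalChainData (L : Type*) [Lattice L] [Fintype L] [BoundedOrder L]
    (n : ℕ) where
  x : Fin (n + 1) → L
  x_strictMono : StrictMono x
  x_bot : x 0 = ⊥
  x_top : x (Fin.last n) = ⊤
  maxlen : ∀ (m : ℕ) (c : Fin (m + 1) → L), StrictMono c → m ≤ n
  j : Fin n → L
  m : Fin n → L
  j_irr : ∀ i, SupIrred (j i)
  m_irr : ∀ i, InfIrred (m i)
  j_inj : Function.Injective j
  m_inj : Function.Injective m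
  j_surj : ∀ a : L, SupIrred a → a ∈ Set.range j
  m_surj : ∀ a : L, InfIrred a → a ∈ Set.range m
  x_eq_sup : ∀ i : Fin (n + 1),
    x i = (Finset.univ.filter fun k : Fin n => (k : ℕ) < (i : ℕ)).sup j
  x_eq_inf : ∀ i : Fin (n + 1),
    x i = (Finset.univ.filter fun k : Fin n => (i : ℕ) ≤ (k : ℕ)).inf m

namespace ExtremalChainData

variable {L : Type*} [Lattice L] [Fintype L] [BoundedOrder L] {n : ℕ}

/-- `x_J`: the set of indices of join-irreducibles lying below `a`. -/
def setJ (D : ExtremalChainData L n) (a : L) : Set (Fin n) := {i | D.j i ≤ a}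

/-- `x_M`: the set of indices of meet-irreducibles lying above `a`. -/
def setM (D : ExtremalChainData L n) (a : L) : Set (Fin n) := {i | a ≤ D.m i}

/-- The Galois graph: a directed edge `i → k` when `jᵢ ≰ m_k` and `i ≠ k`. -/
def galoisEdge (D : ExtremalChainData L n) (i k : Fin n) : Prop :=
  ¬ D.j i ≤ D.m k ∧ i ≠ k

/-- The left modular labelling: `i` is the label of the cover `y ⋖ z` iff `i` is
minimal with `y ⊔ (xᵢ ⊓ z) = z`. -/
def IsLabel (D : ExtremalChainData L n) (y z : L) (i : Fin n) : Prop :=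
  y ⊔ (D.x i.succ ⊓ z) = z ∧ ∀ k : Fin n, y ⊔ (D.x k.succ ⊓ z) = z → i ≤ k

open scoped Classical in
/-- `D^γ(a)`: the set of labels of cover relations below `a`. -/
noncomputable def downLabels (D : ExtremalChainData L n) (a : L) : Finset (Fin n) :=
  Finset.univ.filter fun i => ∃ y, y ⋖ a ∧ D.IsLabel y a i

open scoped Classical in
/-- `U^γ(a)`: the set of labels of cover relations above `a`. -/
noncomputable def upLabels (D : ExtremalChainData L n) (a : L) : Finset (Fin n) :=
  Finset.univ.filter fun i => ∃ z, a ⋖ z ∧ D.IsLabel a z i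

/-- The fixed chain consists of left modular elements, i.e. the lattice is trim. -/
def IsTrim (D : ExtremalChainData L n) : Prop := ∀ i, LeftModular (D.x i)

end ExtremalChainData

open ExtremalChainData

namespace ExtremalChainData

variable {L : Type*} [Lattice L] [Fintype L] [BoundedOrder L] {n : ℕ}
  (D : ExtremalChainData L n)

lemma j_le_x {k : Fin n} {i : Fin (n + 1)} (h : (k : ℕ) < i) : D.j k ≤ D.x i := by
  rw [D.x_eq_sup]
  exact Finset.le_sup (by simpa using h)

lemma x_le_m {k : Fin n} {i : Fin (n + 1)} (h : (i : ℕ) ≤ k) : D.x i ≤ D.m k := by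
  rw [D.x_eq_inf]
  exact Finset.inf_le (by simpa using h)

lemma x_succ_le {t : Fin n} {a : L} (h : D.x t.castSucc ≤ a) (hj : D.j t ≤ a) :
    D.x t.succ ≤ a := by
  rw [D.x_eq_sup]
  refine Finset.sup_le fun k hk => ?_
  have hk' : (k : ℕ) < t + 1 := by simpa using hk
  rcases Nat.lt_succ_iff_lt_or_eq.mp hk' with h1 | h1
  · exact (D.j_le_x (by simpa using h1)).trans h
  · rwa [Fin.ext h1]

lemma j_not_le_m (t : Fin n) : ¬ D.j t ≤ D.m t := by
  intro h
  have hlt : D.x t.castSucc < D.x t.succ := D.x_strictMono (by simp [Fin.lt_def])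
  refine hlt.not_ge (D.x_succ_le le_rfl ?_)
  rw [D.x_eq_inf]
  refine Finset.le_inf fun k hk => ?_
  have hk' : (t : ℕ) ≤ k := by simpa using hk
  rcases hk'.eq_or_lt with h1 | h1
  · rwa [← Fin.ext h1]
  · exact (D.j_le_x (i := t.succ) (by simp)).trans (D.x_le_m (by simpa using h1))

lemma j_le_m_of_lt {i k : Fin n} (h : i < k) : D.j i ≤ D.m k :=
  (D.j_le_x (i := i.succ) (by simp)).trans (D.x_le_m (by simpa using h))

lemma le_of_forall_j_le {a b : L} (h : ∀ i, D.j i ≤ a → D.j i ≤ b) : a ≤ b := by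
  obtain ⟨s, hs, hirr⟩ := exists_supIrred_decomposition a
  rw [← hs]
  refine Finset.sup_le fun c hc => ?_
  obtain ⟨i, rfl⟩ := D.j_surj c (hirr hc)
  exact h i (hs ▸ Finset.le_sup (f := id) hc)

lemma le_of_forall_le_m {a b : L} (h : ∀ i, b ≤ D.m i → a ≤ D.m i) : a ≤ b := by
  obtain ⟨s, hs, hirr⟩ := exists_infIrred_decomposition b
  rw [← hs]
  refine Finset.le_inf fun c hc => ?_
  obtain ⟨i, rfl⟩ := D.m_surj c (hirr hc)
  exact h i (hs ▸ Finset.inf_le (f := id) hc)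

variable {D}

/-- If no index below `i` satisfies `j t ≤ b` and `u ≤ m t`, then the image in `[u, b]` of the
left modular chain is still at `u` after `i` steps. -/
lemma IsTrim.x_inf_le (hD : D.IsTrim) {u b : L} (hub : u ≤ b) (i : Fin (n + 1))
    (h : ∀ t : Fin n, (t : ℕ) < i → D.j t ≤ b → ¬ u ≤ D.m t) : D.x i ⊓ b ≤ u := by
  induction i using Fin.induction with
  | zero => simp [D.x_bot]
  | succ t ih =>
    have ih' := ih fun s hs => h s (by simp at hs ⊢; omega)
    by_cases hj : D.j t ≤ b
    · have hm := h t (by simp) hj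
      have key : u ⊔ D.x t.succ ≤ u ⊔ D.x t.castSucc := by
        refine D.le_of_forall_le_m fun s hs => sup_le (le_sup_left.trans hs) ?_
        have hst : (t : ℕ) ≤ s := by
          by_contra! hlt
          exact D.j_not_le_m s
            ((D.j_le_x (i := t.castSucc) (by simpa using hlt)).trans (le_sup_right.trans hs))
        rcases hst.eq_or_lt with h1 | h1
        · rw [Fin.ext h1] at hm
          exact absurd (le_sup_left.trans hs) hm
        · exact D.x_le_m (by simpa using h1)
      calc D.x t.succ ⊓ b ≤ (u ⊔ D.x t.castSucc) ⊓ b :=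
            inf_le_inf_right _ (le_sup_right.trans key)
        _ = u ⊔ (D.x t.castSucc ⊓ b) := hD _ _ _ hub
        _ ≤ u := sup_le le_rfl ih'
    · refine le_trans (le_inf (D.le_of_forall_j_le fun s hs => ?_) inf_le_right) ih'
      refine D.j_le_x ?_
      have h1 := hs.trans inf_le_left
      have hst : (s : ℕ) ≤ t := by
        by_contra! hlt
        exact D.j_not_le_m s (h1.trans (D.x_le_m (by simpa using hlt)))
      rcases hst.eq_or_lt with h2 | h2
      · rw [Fin.ext h2] at hs
        exact absurd (hs.trans inf_le_right) hj
      · simpa using h2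

lemma IsTrim.exists_j_le_le_m (hD : D.IsTrim) {u b : L} (hub : u < b) :
    ∃ t, D.j t ≤ b ∧ u ≤ D.m t := by
  by_contra! h
  have := hD.x_inf_le hub.le (Fin.last n) fun t _ => h t
  rw [D.x_top, top_inf_eq] at this
  exact hub.not_ge this

lemma sup_x_succ_inf_eq {u b : L} (hub : u ⋖ b) {t : Fin n} (hj : D.j t ≤ b)
    (hm : u ≤ D.m t) : u ⊔ (D.x t.succ ⊓ b) = b := by
  refine (hub.eq_or_eq le_sup_left (sup_le hub.le inf_le_right)).resolve_left fun h => ?_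
  refine D.j_not_le_m t (le_trans ?_ hm)
  rw [← h]
  exact le_sup_of_le_right (le_inf (D.j_le_x (by simp)) hj)

lemma IsTrim.isLabel_iff (hD : D.IsTrim) {u b : L} (hub : u ⋖ b) {i : Fin n} :
    D.IsLabel u b i ↔ D.j i ≤ b ∧ u ≤ D.m i := by
  constructor
  · rintro ⟨h1, h2⟩
    obtain ⟨t, ht, hj, hm⟩ :
        ∃ t : Fin n, (t : ℕ) < i.succ ∧ D.j t ≤ b ∧ u ≤ D.m t := by
      by_contra! h
      rw [sup_eq_left.mpr (hD.x_inf_le hub.le i.succ h)] at h1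
      exact hub.ne h1
    have hit : i ≤ t := h2 t (sup_x_succ_inf_eq hub hj hm)
    obtain rfl : i = t := le_antisymm hit (by simp at ht; omega)
    exact ⟨hj, hm⟩
  · rintro ⟨hj, hm⟩
    refine ⟨sup_x_succ_inf_eq hub hj hm, fun k hk => ?_⟩
    by_contra! hlt
    refine D.j_not_le_m i (hj.trans ?_)
    rw [← hk]
    exact sup_le hm (inf_le_left.trans (D.x_le_m (by simpa using hlt)))

lemma IsTrim.mem_downLabels (hD : D.IsTrim) {a : L} {i : Fin n} :
    i ∈ D.downLabels a ↔ D.j i ≤ a ∧ ∃ u, u ⋖ a ∧ u ≤ D.m i := by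
  simp only [downLabels, Finset.mem_filter, Finset.mem_univ, true_and]
  constructor
  · rintro ⟨u, hu, hl⟩
    have := (hD.isLabel_iff hu).mp hl
    exact ⟨this.1, u, hu, this.2⟩
  · rintro ⟨hj, u, hu, hm⟩
    exact ⟨u, hu, (hD.isLabel_iff hu).mpr ⟨hj, hm⟩⟩

lemma inf_m_eq {a u : L} {i : Fin n} (hj : D.j i ≤ a) (hu : u ⋖ a) (hm : u ≤ D.m i) :
    a ⊓ D.m i = u :=
  (hu.eq_or_eq (le_inf hu.le hm) inf_le_left).resolve_right fun h =>
    D.j_not_le_m i (hj.trans (inf_eq_left.mp h))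

/-- If `q ≤ m t`, then `q ⊔ j t` has a lower cover in `[q, m t]`. -/
lemma IsTrim.exists_covBy_sup_j (hD : D.IsTrim) {q : L} {t : Fin n} (hq : q ≤ D.m t) :
    ∃ w, w ⋖ q ⊔ D.j t ∧ w ≤ D.m t := by
  have hne : ¬ q ⊔ D.j t ≤ q ⊔ D.x t.castSucc := fun h =>
    D.j_not_le_m t ((le_sup_right.trans h).trans (sup_le hq (D.x_le_m (by simp))))
  obtain ⟨w, hwle, hw⟩ := (Set.toFinite
    {w | q ≤ w ∧ ¬ w ≤ q ⊔ D.x t.castSucc}).exists_le_minimal ⟨le_sup_left, hne⟩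
  have hqw : q < w := lt_of_le_of_ne hw.prop.1 fun h => hw.prop.2 (h ▸ le_sup_left)
  obtain ⟨v, hqv, hvw⟩ := exists_le_covBy_of_lt hqw
  have hv : v ≤ q ⊔ D.x t.castSucc := by
    by_contra h
    exact hvw.lt.not_ge (hw.le_of_le ⟨hqv, h⟩ hvw.le)
  obtain ⟨s, hj, hm⟩ := hD.exists_j_le_le_m hvw.lt
  have hst : s ≤ t := by
    by_contra! hlt
    exact D.j_not_le_m s (hj.trans (hwle.trans
      (sup_le (hqv.trans hm) (D.j_le_m_of_lt hlt))))
  rcases hst.eq_or_lt with rfl | hlt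
  · obtain rfl : w = q ⊔ D.j s := le_antisymm hwle (sup_le hqw.le hj)
    exact ⟨v, hvw, hm⟩
  · refine absurd ?_ hw.prop.2
    have hsup : v ⊔ D.j s = w :=
      (hvw.eq_or_eq le_sup_left (sup_le hvw.le hj)).resolve_left fun h =>
        D.j_not_le_m s ((sup_eq_left.mp h).trans hm)
    rw [← hsup]
    exact sup_le hv (le_sup_of_le_right (D.j_le_x (by simpa using hlt)))

/-- Every nontrivial interval `[z, b]` has a smallest label. -/
lemma IsTrim.exists_min_label (hD : D.IsTrim) {z b : L} (hzb : z < b) :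
    ∃ k, D.j k ≤ b ∧ z ≤ D.m k ∧ ∀ t, D.j t ≤ b → z ≤ D.m t → k ≤ t := by
  obtain ⟨k, hk⟩ := (Set.toFinite {t | D.j t ≤ b ∧ z ≤ D.m t}).exists_minimal
    (hD.exists_j_le_le_m hzb)
  refine ⟨k, hk.prop.1, hk.prop.2, fun t h1 h2 => ?_⟩
  exact (le_total k t).elim id fun h => hk.le_of_le ⟨h1, h2⟩ h

section MinLabel

variable {z b : L} {k : Fin n}

lemma IsTrim.j_le_of_not_le_m (hD : D.IsTrim) (hj : D.j k ≤ b)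
    (hmin : ∀ t, D.j t ≤ b → z ≤ D.m t → k ≤ t) {u : L} (hzu : z ≤ u) (hub : u ≤ b)
    (hu : ¬ u ≤ D.m k) : D.j k ≤ u := by
  refine le_trans (le_inf (D.j_le_x (i := k.succ) (by simp)) hj)
    (hD.x_inf_le hub k.succ fun t ht hjt hmt => ?_)
  have hkt := hmin t hjt (hzu.trans hmt)
  obtain rfl : k = t := le_antisymm hkt (by simp at ht; omega)
  exact hu hmt

lemma IsTrim.covBy_sup_j (hD : D.IsTrim) (hj : D.j k ≤ b)
    (hmin : ∀ t, D.j t ≤ b → z ≤ D.m t → k ≤ t) {u : L} (hzu : z ≤ u) (hub : u ≤ b)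
    (hu : u ≤ D.m k) : u ⋖ u ⊔ D.j k := by
  refine ⟨left_lt_sup.mpr fun h => D.j_not_le_m k (h.trans hu), fun v huv hv => ?_⟩
  have hvb : v ≤ b := hv.le.trans (sup_le hub hj)
  have hjv : ¬ D.j k ≤ v := fun h => hv.not_ge (sup_le huv.le h)
  obtain ⟨t, hjt, hmt⟩ := hD.exists_j_le_le_m huv
  rcases (hmin t (hjt.trans hvb) (hzu.trans hmt)).eq_or_lt with rfl | hlt
  · exact hjv hjt
  · exact D.j_not_le_m t ((hjt.trans hv.le).trans (sup_le hmt (D.j_le_m_of_lt hlt)))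

end MinLabel

/-- `b` is the join of `z` and the join-irreducibles indexed by the labels of the lower covers of
`b` in `[z, b]`. -/
lemma IsTrim.le_of_forall_downLabels (hD : D.IsTrim) {b e : L} (z : L) (hzb : z ≤ b)
    (hze : z ≤ e) (h : ∀ r ∈ D.downLabels b, z ≤ D.m r → D.j r ≤ e) : b ≤ e := by
  induction z using WellFoundedGT.induction generalizing e with
  | ind z ih =>
  rcases hzb.eq_or_lt with rfl | hlt
  · exact hze
  obtain ⟨k, hj, hm, hmin⟩ := hD.exists_min_label hlt
  have hzp : z < z ⊔ D.j k := left_lt_sup.mpr fun h => D.j_not_le_m k (h.trans hm)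
  have step : ∀ {e'}, z ≤ e' → D.j k ≤ e' →
      (∀ r ∈ D.downLabels b, z ≤ D.m r → D.j r ≤ e') → b ≤ e' := fun h1 h2 h3 =>
    ih (z ⊔ D.j k) hzp (sup_le hzb hj) (sup_le h1 h2)
      fun r hr hr' => h3 r hr (le_sup_left.trans hr')
  by_cases hke : D.j k ≤ e
  · exact step hze hke h
  have hzi : z ≤ e ⊓ b := le_inf hze hzb
  have hem : e ⊓ b ≤ D.m k := by
    by_contra hc
    exact hke ((hD.j_le_of_not_le_m hj hmin hzi inf_le_right hc).trans inf_le_left)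
  have hcov := hD.covBy_sup_j hj hmin hzi inf_le_right hem
  have hb : e ⊓ b ⊔ D.j k = b := by
    refine le_antisymm (sup_le inf_le_right hj)
      (step (le_sup_of_le_left hzi) le_sup_right fun r hr hr' => le_sup_of_le_left ?_)
    exact le_inf (h r hr hr') (hD.mem_downLabels.mp hr).1
  rw [hb] at hcov
  exact absurd (h k (hD.mem_downLabels.mpr ⟨hj, _, hcov, hem⟩) hm) hke

lemma IsTrim.j_le_m_of_mem_downLabels_of_le (hD : D.IsTrim) {b : L} (z : L) (hzb : z ≤ b)
    {i l : Fin n} (hi : i ∈ D.downLabels b) (hl : l ∈ D.downLabels b) (hil : i ≠ l)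
    (hzi : z ≤ D.m i) (hzl : z ≤ D.m l) : D.j i ≤ D.m l := by
  induction z using WellFoundedGT.induction generalizing i l with
  | ind z ih =>
  rcases hil.lt_or_gt with hlt | hli
  · exact D.j_le_m_of_lt hlt
  have hji := (hD.mem_downLabels.mp hi).1
  obtain ⟨hjl, y, hy, hym⟩ := hD.mem_downLabels.mp hl
  have hzb' : z < b := lt_of_le_of_ne hzb fun h =>
    D.j_not_le_m i (hji.trans (h ▸ hzi))
  obtain ⟨k, hj, hm, hmin⟩ := hD.exists_min_label hzb'
  have hzp : z < z ⊔ D.j k := left_lt_sup.mpr fun h => D.j_not_le_m k (h.trans hm)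
  have hki : k < i := (hmin l hjl hzl).trans_lt hli
  rcases (hmin l hjl hzl).eq_or_lt with rfl | hkl
  · by_contra hil'
    have hzy : z ≤ y := inf_m_eq hjl hy hym ▸ le_inf hzb hzl
    have hsup : y ⊔ D.j k = b :=
      (hy.eq_or_eq le_sup_left (sup_le hy.le hj)).resolve_left fun h =>
        D.j_not_le_m k ((sup_eq_left.mp h).trans hym)
    have hyi : y ≤ D.m i := by
      refine hD.le_of_forall_downLabels z hzy hzi fun s hs hzs => ?_
      obtain ⟨hjs, v, hv, hvm⟩ := hD.mem_downLabels.mp hs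
      have hks : k < s := lt_of_le_of_ne (hmin s (hjs.trans hy.le) hzs) fun h =>
        D.j_not_le_m k (le_trans (h ▸ hjs) hym)
      have hvs : v ⊔ D.j s = y :=
        (hv.eq_or_eq le_sup_left (sup_le hv.le hjs)).resolve_left fun h =>
          D.j_not_le_m s ((sup_eq_left.mp h).trans hvm)
      obtain ⟨w, hw, hwm⟩ := hD.exists_covBy_sup_j (sup_le hvm (D.j_le_m_of_lt hks))
      rw [sup_right_comm, hvs, hsup] at hw
      refine ih (z ⊔ D.j k) hzp (sup_le hzb hj)
        (hD.mem_downLabels.mpr ⟨hjs.trans hy.le, w, hw, hwm⟩) hi ?_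
        (sup_le hzs (D.j_le_m_of_lt hks)) (sup_le hzi (D.j_le_m_of_lt hki))
      rintro rfl
      exact hil' (hjs.trans hym)
    exact D.j_not_le_m i (hji.trans (hsup ▸ sup_le hyi (D.j_le_m_of_lt hki)))
  · exact ih (z ⊔ D.j k) hzp (sup_le hzb hj) hi hl hil
      (sup_le hzi (D.j_le_m_of_lt hki)) (sup_le hzl (D.j_le_m_of_lt hkl))

/-- Downward label sets are independent in the Galois graph. -/
lemma IsTrim.j_le_m_of_mem_downLabels (hD : D.IsTrim) {b : L} {i l : Fin n}
    (hi : i ∈ D.downLabels b) (hl : l ∈ D.downLabels b) (hil : i ≠ l) : D.j i ≤ D.m l :=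
  hD.j_le_m_of_mem_downLabels_of_le ⊥ bot_le hi hl hil bot_le bot_le

/-- Every independent set of the Galois graph is the downward label set of the join of the
join-irreducibles it indexes. -/
lemma IsTrim.downLabels_sup_j (hD : D.IsTrim) {S : Finset (Fin n)}
    (hS : ∀ i ∈ S, ∀ k ∈ S, i ≠ k → D.j i ≤ D.m k) : D.downLabels (S.sup D.j) = S := by
  have hsub : ∀ i ∈ S, i ∈ D.downLabels (S.sup D.j) := fun i hi => by
    have hq : (S.erase i).sup D.j ≤ D.m i := Finset.sup_le fun k hk =>
      hS k (Finset.mem_of_mem_erase hk) i hi (Finset.ne_of_mem_erase hk)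
    obtain ⟨w, hw, hwm⟩ := hD.exists_covBy_sup_j hq
    rw [sup_comm, ← Finset.sup_insert, Finset.insert_erase hi] at hw
    exact hD.mem_downLabels.mpr ⟨Finset.le_sup hi, w, hw, hwm⟩
  refine Finset.Subset.antisymm (fun r hr => ?_) hsub
  by_contra hrS
  refine D.j_not_le_m r ((hD.mem_downLabels.mp hr).1.trans (Finset.sup_le fun i hi => ?_))
  exact hD.j_le_m_of_mem_downLabels (hsub i hi) hr fun h => hrS (h ▸ hi)

end ExtremalChainData

/-- For a trim lattice, the collection `γ(L) = { D^γ(a) : a ∈ L }` of downward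
label sets is a flag simplicial complex on `[n]`: it is closed under subsets,
and a set belongs to it as soon as all of its 2-element subsets do. -/
theorem independence_complex_flag {L : Type*} [Lattice L] [Fintype L] [BoundedOrder L]
    {n : ℕ} (D : ExtremalChainData L n) (hD : D.IsTrim) :
    (∀ S : Finset (Fin n), (∃ a : L, D.downLabels a = S) →
      ∀ T ⊆ S, ∃ b : L, D.downLabels b = T) ∧
    (∀ S : Finset (Fin n),
      (∀ i ∈ S, ∀ k ∈ S, i ≠ k → ∃ a : L, D.downLabels a = {i, k}) →
      ∃ a : L, D.downLabels a = S) := by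
  refine ⟨?_, fun S hS => ⟨S.sup D.j, hD.downLabels_sup_j fun i hi k hk hik => ?_⟩⟩
  · rintro S ⟨a, rfl⟩ T hT
    exact ⟨T.sup D.j, hD.downLabels_sup_j fun i hi k hk hik =>
      hD.j_le_m_of_mem_downLabels (hT hi) (hT hk) hik⟩
  · obtain ⟨a, ha⟩ := hS i hi k hk hik
    exact hD.j_le_m_of_mem_downLabels (b := a) (by simp [ha]) (by simp [ha]) hik
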